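/- arXiv:2203.14770 — 3 statements merged into one kernel-verified Lean document; each statement's English description precedes it below -/
import Mathlib

section
/- Let n ≥ 2 and let F ⊆ S^{2n−1} be nonempty. If the suspension S₀(F) has a regular leaf, then S₀(F) is normal: every formal power series S ∈ ℂ[[z₁,…,zₙ]] such that, for each v ∈ F, the one-variable series S(tv) ∈ ℂ[[t]] has a positive radius of convergence, converges uniformly on some neighborhood of the origin in ℂⁿ. -/
open MeasureTheory Filter Metric Set
open scoped ENNReal

noncomputable section

/-- The nonnegative part of an extended real, as an element of `ℝ≥0∞`. -/
def erealToENNReal (x : EReal) : ℝ≥0∞ :=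
  if x = ⊤ then ⊤ else ENNReal.ofReal x.toReal

/-- Integral of an `EReal`-valued function: the integral of the positive part minus
the integral of the negative part (both computed as lower integrals). -/
def erealIntegral {α : Type*} [MeasurableSpace α] (μ : Measure α) (g : α → EReal) : EReal :=
  ((∫⁻ x, erealToENNReal (g x) ∂μ : ℝ≥0∞) : EReal)
    - ((∫⁻ x, erealToENNReal (-(g x)) ∂μ : ℝ≥0∞) : EReal)

/-- The mean of an `EReal`-valued function over the circle of radius `r` centered at `a`
along the complex line through `a` with direction `b`. -/
def circleLineMean {E : Type*} [AddCommGroup E] [Module ℂ E]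
    (u : E → EReal) (a b : E) (r : ℝ) : EReal :=
  (((2 * Real.pi)⁻¹ : ℝ) : EReal) *
    erealIntegral (volume.restrict (Set.Ioc (0:ℝ) (2 * Real.pi)))
      (fun θ : ℝ => u (a + (r * Complex.exp (θ * Complex.I)) • b))

/-- `u : ℂᵐ → [-∞,∞)` is plurisubharmonic: upper semicontinuous, not identically `-∞`,
never `+∞`, and satisfying the sub-mean value inequality over circles on every complex line. -/
def IsPSH {m : ℕ} (u : EuclideanSpace ℂ (Fin m) → EReal) : Prop :=
  UpperSemicontinuous u ∧ (∃ z, u z ≠ ⊥) ∧ (∀ z, u z ≠ ⊤) ∧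
    ∀ (a b : EuclideanSpace ℂ (Fin m)) (r : ℝ), 0 < r → u a ≤ circleLineMean u a b r

/-- A set `E ⊆ ℂᵐ` is pluripolar if it is contained in the `-∞` set of some
plurisubharmonic function. -/
def Pluripolar {m : ℕ} (E : Set (EuclideanSpace ℂ (Fin m))) : Prop :=
  ∃ u, IsPSH u ∧ ∀ z ∈ E, u z = ⊥

/-- The Lelong class `L_m` of plurisubharmonic functions of logarithmic growth. -/
def LelongClass (m : ℕ) : Set (EuclideanSpace ℂ (Fin m) → EReal) :=
  {u | IsPSH u ∧ ∃ C : ℝ, ∀ z, u z ≤ ((C + Real.log (1 + ‖z‖) : ℝ) : EReal)}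

/-- The Siciak extremal function `V_E`. -/
def extremalFn {m : ℕ} (E : Set (EuclideanSpace ℂ (Fin m))) (z : EuclideanSpace ℂ (Fin m)) :
    EReal :=
  sSup {x : EReal | ∃ u ∈ LelongClass m, (∀ w ∈ E, u w ≤ 0) ∧ x = u z}

/-- The upper regularization `V*_E(a) = limsup_{w → a} V_E(w)`. -/
def extremalFnStar {m : ℕ} (E : Set (EuclideanSpace ℂ (Fin m)))
    (a : EuclideanSpace ℂ (Fin m)) : EReal :=
  Filter.limsup (extremalFn E) (nhds a)

/-- `E` is L-regular at `a`. -/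
def LRegularAt {m : ℕ} (E : Set (EuclideanSpace ℂ (Fin m)))
    (a : EuclideanSpace ℂ (Fin m)) : Prop :=
  extremalFnStar E a = 0

/-- `E` is locally L-regular at `a`. -/
def LocallyLRegularAt {m : ℕ} (E : Set (EuclideanSpace ℂ (Fin m)))
    (a : EuclideanSpace ℂ (Fin m)) : Prop :=
  ∀ r : ℝ, 0 < r → LRegularAt (E ∩ Metric.ball a r) a

/-- The `i`-th direction set `F'_i ⊆ ℂ^{n-1}`. -/
def dirSetI {m : ℕ} (F : Set (EuclideanSpace ℂ (Fin (m + 1)))) (i : Fin (m + 1)) :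
    Set (EuclideanSpace ℂ (Fin m)) :=
  {w | ∃ z ∈ F, z i ≠ 0 ∧ ∀ j : Fin m, w j = z (i.succAbove j) / z i}

/-- The direction set `F' = ∪ᵢ F'_i`. -/
def dirSet {m : ℕ} (F : Set (EuclideanSpace ℂ (Fin (m + 1)))) :
    Set (EuclideanSpace ℂ (Fin m)) :=
  ⋃ i, dirSetI F i

/-- `v ∈ F̄` generates a regular leaf of `S₀(F)`. -/
def GeneratesRegularLeaf {m : ℕ} (F : Set (EuclideanSpace ℂ (Fin (m + 1))))
    (v : EuclideanSpace ℂ (Fin (m + 1))) : Prop :=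
  v ∈ closure F ∧ ∃ i : Fin (m + 1), v i ≠ 0 ∧
    LocallyLRegularAt (dirSetI F i)
      (WithLp.toLp 2 (fun j : Fin m => v (i.succAbove j) / v i : Fin m → ℂ) :
        EuclideanSpace ℂ (Fin m))

/-- The coefficients of the one-variable restriction `t ↦ S(tv)` of a formal power series. -/
def lineCoeff {n : ℕ} (S : MvPowerSeries (Fin n) ℂ) (v : EuclideanSpace ℂ (Fin n)) (k : ℕ) :
    ℂ :=
  ∑ I ∈ Finset.Nat.antidiagonalTuple n k,
    MvPowerSeries.coeff (Finsupp.equivFunOnFinite.symm I) S * ∏ i, v i ^ I i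

/-- A one-variable power series (given by its coefficients) has a positive radius of
convergence. -/
def HasPosRadius (c : ℕ → ℂ) : Prop :=
  ∃ r : ℝ, 0 < r ∧ Summable fun k => ‖c k‖ * r ^ k

/-- The degree-wise partial sums of a formal power series in `n` variables. -/
def partialSum {n : ℕ} (S : MvPowerSeries (Fin n) ℂ) (N : ℕ) (z : EuclideanSpace ℂ (Fin n)) :
    ℂ :=
  ∑ k ∈ Finset.range N, ∑ I ∈ Finset.Nat.antidiagonalTuple n k,
    MvPowerSeries.coeff (Finsupp.equivFunOnFinite.symm I) S * ∏ i, z i ^ I i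

/-- `S` converges uniformly on some neighborhood of the origin. -/
def ConvUnifNearZero {n : ℕ} (S : MvPowerSeries (Fin n) ℂ) : Prop :=
  ∃ r : ℝ, 0 < r ∧ ∃ g : EuclideanSpace ℂ (Fin n) → ℂ,
    TendstoUniformlyOn (partialSum S) g Filter.atTop
      (Metric.ball (0 : EuclideanSpace ℂ (Fin n)) r)

/-- minus log, valued in `[0,∞]` -/
def nl (y : ℝ) : ℝ≥0∞ := (-(ENNReal.log (ENNReal.ofReal y))).toENNReal

lemma nl_pos {y : ℝ} (hy : 0 < y) : nl y = ENNReal.ofReal (-Real.log y) := by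
  unfold nl
  rw [ENNReal.log_ofReal_of_pos hy, ← EReal.coe_neg, EReal.toENNReal_of_ne_top (by simp)]
  simp

lemma nl_zero : nl 0 = ⊤ := by simp [nl]

lemma nl_cont : Continuous nl := by
  unfold nl
  exact EReal.continuous_toENNReal.comp (continuous_neg.comp
    (ENNReal.continuous_log.comp ENNReal.continuous_ofReal))

lemma nl_anti {x y : ℝ} (h : x ≤ y) : nl y ≤ nl x := by
  unfold nl
  apply EReal.toENNReal_le_toENNReal
  rw [EReal.neg_le_neg_iff]
  exact ENNReal.log_le_log (ENNReal.ofReal_le_ofReal h)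

lemma circle_ne_ae (f : ℂ → ℂ) (hf : Differentiable ℂ f) {r : ℝ} (hr : 0 < r) (h0 : f 0 ≠ 0) :
    ∀ᵐ θ ∂(volume.restrict (Set.Ioc (0:ℝ) (2 * Real.pi))), f (circleMap 0 r θ) ≠ 0 := by
  have han : AnalyticOnNhd ℝ (fun θ : ℝ => f (circleMap 0 r θ)) Set.univ := by
    intro θ _
    have h1 : AnalyticAt ℝ f (circleMap 0 r θ) := (hf.analyticAt _).restrictScalars
    have h2 : AnalyticAt ℝ (circleMap 0 r) θ := analyticOnNhd_circleMap 0 r θ trivial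
    exact h1.comp h2
  have hne : ∃ θ : ℝ, f (circleMap 0 r θ) ≠ 0 := by
    by_contra! hall
    apply h0
    have : ‖f 0‖ ≤ 0 := by
      refine Complex.norm_le_of_forall_mem_frontier_norm_le (U := Metric.ball 0 r)
        Metric.isBounded_ball hf.diffContOnCl ?_ (subset_closure (by simpa using hr))
      intro z hz
      rw [frontier_ball _ hr.ne'] at hz
      have : z ∈ Set.range (circleMap 0 r) := by
        rw [range_circleMap, abs_of_pos hr]; exact hz
      obtain ⟨θ, rfl⟩ := this
      simp [hall θ]
    simpa using this
  obtain ⟨θ0, hθ0⟩ := hne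
  have hc := han.preimage_zero_mem_codiscrete hθ0
  apply ae_restrict_le_codiscreteWithin measurableSet_Ioc
  have := Filter.codiscreteWithin_mono (subset_univ (Set.Ioc (0:ℝ) (2 * Real.pi))) hc
  filter_upwards [this] with x hx
  simpa using hx

lemma jensen (f : ℂ → ℂ) (hf : Differentiable ℂ f) {r : ℝ} (hr : 0 < r) (h0 : f 0 ≠ 0) :
    Integrable (fun θ => Real.log ‖f (circleMap 0 r θ)‖)
      (volume.restrict (Set.Ioc (0:ℝ) (2 * Real.pi))) ∧
    2 * Real.pi * Real.log ‖f 0‖ ≤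
      ∫ θ in Set.Ioc (0:ℝ) (2 * Real.pi), Real.log ‖f (circleMap 0 r θ)‖ := by
  have hA : AnalyticOnNhd ℂ f (closedBall 0 |r|) := fun z _ => hf.analyticAt z
  have hI : CircleIntegrable (fun z => Real.log ‖f z‖) 0 r :=
    (hA.mono sphere_subset_closedBall).meromorphicOn.circleIntegrable_log_norm
  have hpi : (0:ℝ) ≤ 2 * Real.pi := by positivity
  have hJ := hA.circleAverage_log_norm hr.ne' h0
  constructor
  · have := (intervalIntegrable_iff_integrableOn_Ioc_of_le hpi).1 hI
    exact this
  · rw [Real.circleAverage_def, intervalIntegral.integral_of_le hpi, smul_eq_mul] at hJ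
    have hS : 0 ≤ ∑ᶠ u, (MeromorphicOn.divisor f (closedBall 0 |r|) u : ℝ) *
        Real.log (r * ‖(0:ℂ) - u‖⁻¹) := by
      apply finsum_nonneg
      intro u
      by_cases hu : u ∈ closedBall (0:ℂ) |r|
      · by_cases hu0 : u = 0
        · simp [hu0]
        refine mul_nonneg (mod_cast MeromorphicOn.AnalyticOnNhd.divisor_nonneg hA u) (Real.log_nonneg ?_)
        have : 0 < ‖u‖ := by simpa using hu0
        rw [zero_sub, norm_neg, ← div_eq_mul_inv, one_le_div this]
        rw [abs_of_pos hr] at hu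
        simpa using hu
      · simp [hu]
    have h2 : (2 * Real.pi) * Real.log ‖f 0‖ ≤ (2 * Real.pi) * ((2 * Real.pi)⁻¹ *
      ∫ θ in Set.Ioc (0:ℝ) (2 * Real.pi), Real.log ‖f (circleMap 0 r θ)‖) := by
      apply mul_le_mul_of_nonneg_left _ hpi
      rw [hJ]; linarith
    rwa [← mul_assoc, mul_inv_cancel₀ (by positivity), one_mul] at h2

lemma nl_submean (f : ℂ → ℂ) (hf : Differentiable ℂ f) {r : ℝ} (hr : 0 < r) {k : ℕ} (hk : 1 ≤ k)
    {A s : ℝ} (hA : 0 < A) (hs : 0 < s)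
    (hle : ∀ θ : ℝ, ‖f (circleMap 0 r θ)‖ ^ ((k:ℝ)⁻¹) / A ≤ s) :
    ∫⁻ θ in Set.Ioc (0:ℝ) (2 * Real.pi), nl (‖f (circleMap 0 r θ)‖ ^ ((k:ℝ)⁻¹) / A / s) ≤
      ENNReal.ofReal (2 * Real.pi) * nl (‖f 0‖ ^ ((k:ℝ)⁻¹) / A / s) := by
  have hpi : (0:ℝ) < 2 * Real.pi := by positivity
  have hk' : (0:ℝ) < (k:ℝ)⁻¹ := by positivity
  by_cases h0 : f 0 = 0
  · rw [h0, norm_zero, Real.zero_rpow hk'.ne', zero_div, zero_div, nl_zero, ENNReal.mul_top]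
    · exact le_top
    · simpa using hpi
  have hlog : ∀ z, f z ≠ 0 → -Real.log (‖f z‖ ^ ((k:ℝ)⁻¹) / A / s) =
      Real.log (A * s) - (k:ℝ)⁻¹ * Real.log ‖f z‖ := by
    intro z hz
    have : 0 < ‖f z‖ := by simpa using hz
    rw [div_div, Real.log_div (by positivity) (by positivity), Real.log_rpow this]; ring
  have hpos : ∀ z, f z ≠ 0 → 0 < ‖f z‖ ^ ((k:ℝ)⁻¹) / A / s := by
    intro z hz
    have : 0 < ‖f z‖ := by simpa using hz
    positivity
  have hae := circle_ne_ae f hf hr h0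
  obtain ⟨hI, hJ⟩ := jensen f hf hr h0
  have e1 : ∫⁻ θ in Set.Ioc (0:ℝ) (2 * Real.pi), nl (‖f (circleMap 0 r θ)‖ ^ ((k:ℝ)⁻¹) / A / s)
     = ∫⁻ θ in Set.Ioc (0:ℝ) (2 * Real.pi), ENNReal.ofReal
        (Real.log (A * s) - (k:ℝ)⁻¹ * Real.log ‖f (circleMap 0 r θ)‖) := by
    apply lintegral_congr_ae
    filter_upwards [hae] with θ hθ
    rw [nl_pos (hpos _ hθ), hlog _ hθ]
  have hI2 : Integrable (fun θ => Real.log (A * s) - (k:ℝ)⁻¹ * Real.log ‖f (circleMap 0 r θ)‖)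
      (volume.restrict (Set.Ioc (0:ℝ) (2 * Real.pi))) :=
    (integrable_const _).sub (hI.const_mul _)
  rw [e1, ← ofReal_integral_eq_lintegral_ofReal hI2, nl_pos (hpos _ h0), hlog _ h0,
    ← ENNReal.ofReal_mul hpi.le]
  · apply ENNReal.ofReal_le_ofReal
    rw [integral_sub (integrable_const _) (hI.const_mul _), integral_const_mul]
    simp only [integral_const, measureReal_restrict_apply MeasurableSet.univ, univ_inter,
      Real.volume_real_Ioc_of_le hpi.le, smul_eq_mul, sub_zero]
    have := mul_le_mul_of_nonneg_left hJ hk'.le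
    linarith
  · filter_upwards [hae] with θ hθ
    rw [← hlog _ hθ]
    have := Real.log_nonpos (hpos _ hθ).le ((div_le_one hs).2 (hle θ))
    simpa using this

lemma nl_shift {a s t : ℝ} (ha : 0 ≤ a) (hs : 0 < s) (has : a ≤ s) (hst : s ≤ t) :
    nl (a / t) = nl (a / s) + ENNReal.ofReal (Real.log (t / s)) := by
  have ht : 0 < t := hs.trans_le hst
  rcases ha.eq_or_lt with rfl | ha
  · simp [nl_zero]
  rw [nl_pos (by positivity), nl_pos (by positivity), ← ENNReal.ofReal_add]
  · congr 1
    rw [Real.log_div ha.ne' ht.ne', Real.log_div ha.ne' hs.ne', Real.log_div ht.ne' hs.ne']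
    ring
  · have := Real.log_nonpos (by positivity) ((div_le_one hs).2 has)
    linarith
  · exact Real.log_nonneg ((one_le_div hs).2 hst)

lemma pt_split (K : ℝ) (hK : 0 ≤ K) (t : ℝ≥0∞) :
    erealToENNReal ((K : EReal) - (t : EReal)) + t =
      ENNReal.ofReal K + erealToENNReal (-((K : EReal) - (t : EReal))) := by
  induction t using ENNReal.recTopCoe with
  | top => simp [erealToENNReal]
  | coe x =>
    have h1 : (K : EReal) - (((x : ℝ≥0∞)) : EReal) = ((K - x : ℝ) : EReal) := by
      rw [EReal.coe_sub]; rfl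
    rw [h1, ← EReal.coe_neg]
    unfold erealToENNReal
    rw [if_neg (EReal.coe_ne_top _), if_neg (EReal.coe_ne_top _), EReal.toReal_coe,
      EReal.toReal_coe]
    rcases le_total K x with h | h
    · rw [ENNReal.ofReal_of_nonpos (by linarith), zero_add, ← ENNReal.ofReal_add hK (by linarith)]
      simp
    · rw [ENNReal.ofReal_of_nonpos (p := -(K - x)) (by linarith), add_zero,
        ← ENNReal.ofReal_coe_nnreal, ← ENNReal.ofReal_add (sub_nonneg.2 h) x.coe_nonneg]
      simp

lemma erealToENNReal_meas : Measurable erealToENNReal := by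
  unfold erealToENNReal
  exact Measurable.ite (measurableSet_singleton _) measurable_const
    (ENNReal.measurable_ofReal.comp measurable_ereal_toReal)

lemma ereal_mean (g : ℝ → EReal) (T : ℝ → ℝ≥0∞) (hT : Measurable T) (K : ℝ) (hK : 0 ≤ K)
    (hg : ∀ θ, g θ = (K : EReal) - (T θ : EReal)) (Ta : ℝ≥0∞)
    (hTa : ∫⁻ θ in Set.Ioc (0:ℝ) (2 * Real.pi), T θ ≤ ENNReal.ofReal (2 * Real.pi) * Ta) :
    (K : EReal) - (Ta : EReal) ≤ (((2 * Real.pi)⁻¹ : ℝ) : EReal) *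
      erealIntegral (volume.restrict (Set.Ioc (0:ℝ) (2 * Real.pi))) g := by
  have hpi : (0:ℝ) < 2 * Real.pi := by positivity
  by_cases hTop : Ta = ⊤
  · simp [hTop]
  unfold erealIntegral
  have hgm : Measurable g := by
    have : g = fun θ => (K : EReal) - (T θ : EReal) := funext hg
    rw [this]
    exact measurable_const.sub (measurable_coe_ennreal_ereal.comp hT)
  have hsum : (∫⁻ θ in Set.Ioc (0:ℝ) (2 * Real.pi), erealToENNReal (g θ))
      + ∫⁻ θ in Set.Ioc (0:ℝ) (2 * Real.pi), T θ =
      ENNReal.ofReal (2 * Real.pi * K)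
        + ∫⁻ θ in Set.Ioc (0:ℝ) (2 * Real.pi), erealToENNReal (-(g θ)) := by
    rw [← lintegral_add_right _ hT]
    simp_rw [hg, pt_split K hK]
    rw [lintegral_add_left measurable_const, lintegral_const]
    rw [mul_comm (2 * Real.pi) K, ENNReal.ofReal_mul hK]; simp
  have hP : ∫⁻ θ in Set.Ioc (0:ℝ) (2 * Real.pi), erealToENNReal (g θ) ≤
      ENNReal.ofReal (2 * Real.pi * K) := by
    calc _ ≤ ∫⁻ θ in Set.Ioc (0:ℝ) (2 * Real.pi), ENNReal.ofReal K := by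
          apply lintegral_mono
          intro θ
          simp only [hg]
          unfold erealToENNReal
          have hne : (K : EReal) - (T θ : EReal) ≠ ⊤ := by
            induction T θ using ENNReal.recTopCoe with
            | top => simp
            | coe x =>
              have h1 : (K : EReal) - (((x : ℝ≥0∞)) : EReal) = ((K - x : ℝ) : EReal) := by
                rw [EReal.coe_sub]; rfl
              rw [h1]; exact EReal.coe_ne_top _
          rw [if_neg hne]
          apply ENNReal.ofReal_le_ofReal
          induction T θ using ENNReal.recTopCoe with
          | top => simpa using hK
          | coe x =>
            have h1 : (K : EReal) - (((x : ℝ≥0∞)) : EReal) = ((K - x : ℝ) : EReal) := by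
              rw [EReal.coe_sub]; rfl
            rw [h1, EReal.toReal_coe]
            linarith [x.2]
      _ = _ := by rw [mul_comm (2 * Real.pi) K, ENNReal.ofReal_mul hK]; simp
  set P := ∫⁻ θ in Set.Ioc (0:ℝ) (2 * Real.pi), erealToENNReal (g θ)
  set N := ∫⁻ θ in Set.Ioc (0:ℝ) (2 * Real.pi), erealToENNReal (-(g θ))
  set I := ∫⁻ θ in Set.Ioc (0:ℝ) (2 * Real.pi), T θ
  have hPf : P ≠ ⊤ := ne_top_of_le_ne_top ENNReal.ofReal_ne_top hP
  have hIf : I ≠ ⊤ := ne_top_of_le_ne_top (ENNReal.mul_ne_top ENNReal.ofReal_ne_top hTop) hTa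
  have hNf : N ≠ ⊤ := by
    intro h
    rw [h, add_top] at hsum
    exact (ENNReal.add_ne_top.2 ⟨hPf, hIf⟩) hsum
  have hr := congrArg ENNReal.toReal hsum
  rw [ENNReal.toReal_add hPf hIf, ENNReal.toReal_add ENNReal.ofReal_ne_top hNf,
    ENNReal.toReal_ofReal (by positivity)] at hr
  have hI2 := ENNReal.toReal_mono (ENNReal.mul_ne_top ENNReal.ofReal_ne_top hTop) hTa
  rw [ENNReal.toReal_mul, ENNReal.toReal_ofReal hpi.le] at hI2
  rw [← EReal.coe_ennreal_toReal hPf, ← EReal.coe_ennreal_toReal hNf,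
    ← EReal.coe_ennreal_toReal hTop, ← EReal.coe_sub, ← EReal.coe_sub, ← EReal.coe_mul,
    EReal.coe_le_coe_iff]
  rw [le_inv_mul_iff₀ hpi]
  linarith

/-- hypotheses on a family of functions `exp v_j` -/
structure Fam (m : ℕ) (a : ℕ → EuclideanSpace ℂ (Fin m) → ℝ) (w : ℕ → ℝ) : Prop where
  cont : ∀ j, Continuous (a j)
  nonneg : ∀ j z, 0 ≤ a j z
  le : ∀ j z, a j z ≤ 1 + ‖z‖
  wnonneg : ∀ j, 0 ≤ w j
  wsum : Summable w
  wle : ∑' j, w j ≤ 1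
  submean : ∀ j (x b : EuclideanSpace ℂ (Fin m)) (r s : ℝ), 0 < r → 0 < s →
    (∀ θ : ℝ, a j (x + (r * Complex.exp (θ * Complex.I)) • b) ≤ s) →
    ∫⁻ θ in Set.Ioc (0:ℝ) (2 * Real.pi), nl (a j (x + (r * Complex.exp (θ * Complex.I)) • b) / s) ≤
      ENNReal.ofReal (2 * Real.pi) * nl (a j x / s)

/-- the sum of the minus logs -/
def TT {m : ℕ} (a : ℕ → EuclideanSpace ℂ (Fin m) → ℝ) (w : ℕ → ℝ) (s : ℝ)
    (z : EuclideanSpace ℂ (Fin m)) : ℝ≥0∞ :=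
  ∑' j, ENNReal.ofReal (w j) * nl (a j z / s)

/-- the Lelong function -/
def uu {m : ℕ} (a : ℕ → EuclideanSpace ℂ (Fin m) → ℝ) (w : ℕ → ℝ) (c : ℝ)
    (z : EuclideanSpace ℂ (Fin m)) : EReal :=
  ((c + (∑' j, w j) * Real.log (1 + ‖z‖) : ℝ) : EReal) - (TT a w (1 + ‖z‖) z : EReal)

section FamSec

variable {m : ℕ} {a : ℕ → EuclideanSpace ℂ (Fin m) → ℝ} {w : ℕ → ℝ}

lemma TT_shift (h : Fam m a w) {s : ℝ} {z : EuclideanSpace ℂ (Fin m)} (hs : 1 + ‖z‖ ≤ s) :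
    TT a w s z = TT a w (1 + ‖z‖) z +
      ENNReal.ofReal ((∑' j, w j) * Real.log (s / (1 + ‖z‖))) := by
  have hz : 0 < 1 + ‖z‖ := by positivity
  unfold TT
  have : ∀ j, ENNReal.ofReal (w j) * nl (a j z / s) =
      ENNReal.ofReal (w j) * nl (a j z / (1 + ‖z‖)) +
      ENNReal.ofReal (w j) * ENNReal.ofReal (Real.log (s / (1 + ‖z‖))) := by
    intro j
    rw [nl_shift (h.nonneg j z) hz (h.le j z) hs, mul_add]
  simp_rw [this]
  rw [ENNReal.tsum_add, ENNReal.tsum_mul_right, ENNReal.ofReal_mul (tsum_nonneg h.wnonneg),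
    ENNReal.ofReal_tsum_of_nonneg h.wnonneg h.wsum]

lemma uu_shift (h : Fam m a w) (c : ℝ) {s : ℝ} {z : EuclideanSpace ℂ (Fin m)} (hs : 1 + ‖z‖ ≤ s) :
    uu a w c z = ((c + (∑' j, w j) * Real.log s : ℝ) : EReal) - (TT a w s z : EReal) := by
  have hz : 0 < 1 + ‖z‖ := by positivity
  have hW : 0 ≤ ∑' j, w j := tsum_nonneg h.wnonneg
  unfold uu
  rw [TT_shift h hs]
  by_cases ht : TT a w (1 + ‖z‖) z = ⊤
  · simp [ht]
  have hl : 0 ≤ (∑' j, w j) * Real.log (s / (1 + ‖z‖)) :=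
    mul_nonneg hW (Real.log_nonneg ((one_le_div hz).2 hs))
  rw [← EReal.coe_ennreal_toReal ht, ← EReal.coe_ennreal_toReal
    (ENNReal.add_ne_top.2 ⟨ht, ENNReal.ofReal_ne_top⟩), ENNReal.toReal_add ht ENNReal.ofReal_ne_top,
    ENNReal.toReal_ofReal hl, ← EReal.coe_sub, ← EReal.coe_sub, EReal.coe_eq_coe_iff,
    Real.log_div (by linarith) hz.ne']
  ring

lemma TT_lsc (h : Fam m a w) (s : EuclideanSpace ℂ (Fin m) → ℝ) (hs : Continuous s)
    (hs0 : ∀ z, s z ≠ 0) : LowerSemicontinuous (fun z => TT a w (s z) z) := by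
  unfold TT
  apply lowerSemicontinuous_tsum
  intro j
  apply Continuous.lowerSemicontinuous
  exact ENNReal.continuous_const_mul ENNReal.ofReal_ne_top |>.comp
    (nl_cont.comp ((h.cont j).div hs hs0))

lemma coe_sub_ne_top (K : ℝ) (t : ℝ≥0∞) : (K : EReal) - (t : EReal) ≠ ⊤ := by
  induction t using ENNReal.recTopCoe with
  | top => simp
  | coe x =>
    have h1 : (K : EReal) - (((x : ℝ≥0∞)) : EReal) = ((K - x : ℝ) : EReal) := by
      rw [EReal.coe_sub]; rfl
    rw [h1]; exact EReal.coe_ne_top _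

lemma uu_lelong (h : Fam m a w) (x0 : EuclideanSpace ℂ (Fin m)) (hx0 : TT a w (1 + ‖x0‖) x0 ≠ ⊤)
    {c : ℝ} (hc : 0 ≤ c) : uu a w c ∈ LelongClass m := by
  have hW : 0 ≤ ∑' j, w j := tsum_nonneg h.wnonneg
  refine ⟨⟨?_, ⟨x0, ?_⟩, ?_, ?_⟩, c, ?_⟩
  · have h1 : LowerSemicontinuous (fun z => (TT a w (1 + ‖z‖) z : EReal)) :=
      continuous_coe_ennreal_ereal.comp_lowerSemicontinuous (TT_lsc h _ (by fun_prop) (fun z => by positivity))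
        (fun x y hxy => EReal.coe_ennreal_le_coe_ennreal_iff.2 hxy)
    have h2 : UpperSemicontinuous (fun z => -(TT a w (1 + ‖z‖) z : EReal)) :=
      continuous_neg.comp_lowerSemicontinuous_antitone h1 (fun x y hxy => EReal.neg_le_neg_iff.2 hxy)
    have h3 : Continuous (fun z : EuclideanSpace ℂ (Fin m) =>
        ((c + (∑' j, w j) * Real.log (1 + ‖z‖) : ℝ) : EReal)) := by
      apply continuous_coe_real_ereal.comp
      refine continuous_const.add (continuous_const.mul (Continuous.log (by fun_prop) (fun z => by positivity)))
    unfold uu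
    simp_rw [sub_eq_add_neg]
    apply UpperSemicontinuous.add' h3.upperSemicontinuous h2
    intro z
    apply EReal.continuousAt_add
    · left; exact EReal.coe_ne_top _
    · left; exact EReal.coe_ne_bot _
  · unfold uu
    rw [← EReal.coe_ennreal_toReal hx0, ← EReal.coe_sub]
    exact EReal.coe_ne_bot _
  · intro z
    exact coe_sub_ne_top _ _
  · intro x b r hr
    set s := 1 + ‖x‖ + r * ‖b‖ with hs
    have hs1 : 1 ≤ s := by have := norm_nonneg x; have := mul_nonneg hr.le (norm_nonneg b); linarith
    have hn : ∀ θ : ℝ, 1 + ‖x + (r * Complex.exp (θ * Complex.I)) • b‖ ≤ s := by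
      intro θ
      have h1 := norm_add_le x (((r:ℂ) * Complex.exp (θ * Complex.I)) • b)
      have h2 : ‖((r:ℂ) * Complex.exp (θ * Complex.I)) • b‖ = r * ‖b‖ := by
        rw [norm_smul, norm_mul, Complex.norm_exp_ofReal_mul_I]
        simp [abs_of_pos hr]
      linarith
    have hx : 1 + ‖x‖ ≤ s := by have := mul_nonneg hr.le (norm_nonneg b); linarith
    unfold circleLineMean
    rw [uu_shift h c hx]
    have hcirc : Continuous (fun θ : ℝ => x + ((r:ℂ) * Complex.exp (θ * Complex.I)) • b) := by
      fun_prop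
    apply ereal_mean _ (fun θ : ℝ => TT a w s (x + (r * Complex.exp (θ * Complex.I)) • b))
    · exact ((TT_lsc h (fun _ => s) continuous_const (fun _ => by positivity)).comp hcirc).measurable
    · have := mul_nonneg hW (Real.log_nonneg hs1)
      linarith
    · intro θ
      exact uu_shift h c (hn θ)
    · unfold TT
      rw [lintegral_tsum, ← ENNReal.tsum_mul_left]
      · apply ENNReal.tsum_le_tsum
        intro j
        rw [lintegral_const_mul' _ _ ENNReal.ofReal_ne_top]
        calc _ ≤ ENNReal.ofReal (w j) * (ENNReal.ofReal (2 * Real.pi) * nl (a j x / s)) := by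
              gcongr
              exact h.submean j x b r s hr (by linarith) (fun θ => (h.le j _).trans (hn θ))
          _ = _ := by ring
      · intro j
        apply Continuous.aemeasurable
        exact ENNReal.continuous_const_mul ENNReal.ofReal_ne_top |>.comp
          (nl_cont.comp (((h.cont j).comp hcirc).div_const s))
  · intro z
    unfold uu
    have hl : 0 ≤ Real.log (1 + ‖z‖) := Real.log_nonneg (by linarith [norm_nonneg z])
    calc _ ≤ ((c + (∑' j, w j) * Real.log (1 + ‖z‖) : ℝ) : EReal) - 0 := by
          apply EReal.sub_le_sub le_rfl
          exact EReal.coe_ennreal_nonneg _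
      _ ≤ _ := by
          rw [sub_zero, EReal.coe_le_coe_iff]
          have := mul_le_mul_of_nonneg_right h.wle hl
          linarith

lemma extremal_top (h : Fam m a w) (x0 : EuclideanSpace ℂ (Fin m)) (hx0 : TT a w (1 + ‖x0‖) x0 ≠ ⊤)
    (E : Set (EuclideanSpace ℂ (Fin m))) (hE : ∀ z ∈ E, TT a w (1 + ‖z‖) z = ⊤) :
    extremalFn E x0 = ⊤ := by
  rw [EReal.eq_top_iff_forall_lt]
  intro y
  set B := (∑' j, w j) * Real.log (1 + ‖x0‖) - (TT a w (1 + ‖x0‖) x0).toReal with hB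
  have hval : ∀ c : ℝ, uu a w c x0 = ((c + B : ℝ) : EReal) := by
    intro c
    unfold uu
    rw [← EReal.coe_ennreal_toReal hx0, ← EReal.coe_sub, hB]
    congr 1
    ring
  have hle : uu a w (|y| + |B| + 1) x0 ≤ extremalFn E x0 := by
    apply le_sSup
    refine ⟨_, uu_lelong h x0 hx0 (by positivity), ?_, rfl⟩
    intro z hz
    unfold uu
    rw [hE z hz]
    simp
  refine lt_of_lt_of_le ?_ hle
  rw [hval, EReal.coe_lt_coe_iff]
  have := le_abs_self y
  have := neg_abs_le B
  linarith

end FamSec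

lemma key_bound {m : ℕ} (p : ℕ → EuclideanSpace ℂ (Fin m) → ℂ) (hp : ∀ k, Differentiable ℂ (p k))
    (N : ℕ → ℝ) (hN0 : ∀ k, 0 ≤ N k) (hN : ∀ k w, ‖p k w‖ ≤ N k * (1 + ‖w‖) ^ k)
    (hBW : ∀ (b : EuclideanSpace ℂ (Fin m)) (ρ : ℝ), 0 < ρ → ∃ C : ℝ, 1 ≤ C ∧ ∀ (k : ℕ) (A : ℝ),
      0 ≤ A → (∀ w ∈ ball b ρ, ‖p k w‖ ≤ A) → N k ≤ A * C ^ k)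
    (E : Set (EuclideanSpace ℂ (Fin m)))
    (hE : ∀ z ∈ E, ∃ B : ℝ, 1 ≤ B ∧ ∀ k, 1 ≤ k → ‖p k z‖ ≤ B ^ k)
    (a0 : EuclideanSpace ℂ (Fin m)) (ha0 : LRegularAt E a0) :
    ∃ C : ℝ, 0 < C ∧ ∀ k, 1 ≤ k → N k ≤ C ^ k := by
  by_contra! hcon
  have hev : ∀ᶠ x in nhds a0, extremalFn E x < 1 := by
    refine Filter.eventually_lt_of_limsup_lt ?_
    have : Filter.limsup (extremalFn E) (nhds a0) = 0 := ha0
    rw [this]; exact zero_lt_one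
  obtain ⟨M, hM⟩ : ∃ M : ℕ → ℝ, ∀ k, M k = Real.log (N k) / k := ⟨_, fun k => rfl⟩
  have hub : ∀ Λ : ℝ, ∃ k, 1 ≤ k ∧ Λ < M k := by
    intro Λ
    obtain ⟨k, hk, h⟩ := hcon (Real.exp Λ) (Real.exp_pos _)
    refine ⟨k, hk, ?_⟩
    have hk0 : (0:ℝ) < k := by exact_mod_cast hk
    rw [hM, lt_div_iff₀ hk0]
    rw [← Real.exp_nat_mul] at h
    rw [Real.lt_log_iff_exp_lt ((Real.exp_pos _).trans h), mul_comm]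
    exact h
  have hNM : ∀ k, 1 ≤ k → 1 ≤ M k → N k = Real.exp (M k) ^ k := by
    intro k hk h1
    have hk0 : (k:ℝ) ≠ 0 := by positivity
    have : N k ≠ 0 := by
      intro h
      rw [hM, h] at h1
      simp at h1
      linarith
    have hpos : 0 < N k := lt_of_le_of_ne (hN0 k) this.symm
    rw [← Real.exp_nat_mul, hM, mul_div_cancel₀ _ hk0, Real.exp_log hpos]
  -- Baire
  let A : ℕ → Set (EuclideanSpace ℂ (Fin m)) := fun n =>
    {x | ∀ k, 1 ≤ k → (n:ℝ) + 1 ≤ M k → ‖p k x‖ ≤ Real.exp (M k - √(M k)) ^ k}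
  have hAclosed : ∀ n, IsClosed (A n) := by
    intro n
    simp only [A, ofPred_forall]
    refine isClosed_iInter fun k => isClosed_iInter fun _ => isClosed_iInter fun _ => ?_
    exact isClosed_le (hp k).continuous.norm continuous_const
  have hAint : ∀ n, interior (A n) = ∅ := by
    intro n
    by_contra hne
    obtain ⟨b, hb⟩ := nonempty_iff_ne_empty.2 hne
    obtain ⟨ρ, hρ, hball⟩ := Metric.isOpen_iff.1 isOpen_interior b hb
    obtain ⟨C, hC1, hC⟩ := hBW b ρ hρ
    obtain ⟨k, hk, hkM⟩ := hub (max (n + 1) (Real.log C ^ 2 + 1))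
    have h1 : (n:ℝ) + 1 < M k := lt_of_le_of_lt (le_max_left _ _) hkM
    have h2 : Real.log C ^ 2 + 1 < M k := lt_of_le_of_lt (le_max_right _ _) hkM
    have h3 := hC k (Real.exp (M k - √(M k)) ^ k) (by positivity)
      (fun w hw => interior_subset (hball hw) k hk h1.le)
    have hn : (0:ℝ) ≤ n := Nat.cast_nonneg n
    rw [hNM k hk (by linarith), ← mul_pow] at h3
    have h4 := (pow_le_pow_iff_left₀ (Real.exp_pos _).le (by positivity) (by omega)).1 h3
    rw [← Real.exp_log (show 0 < C by linarith), ← Real.exp_add, Real.exp_le_exp] at h4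
    have h5 : Real.log C < √(M k) := Real.lt_sqrt_of_sq_lt (by linarith)
    linarith
  have hdense : Dense (⋂ n, (A n)ᶜ) := by
    apply dense_iInter_of_isOpen_nat
    · intro n; exact (hAclosed n).isOpen_compl
    · intro n; exact interior_eq_empty_iff_dense_compl.1 (hAint n)
  obtain ⟨δ, hδ, hδb⟩ := Metric.eventually_nhds_iff_ball.1 hev
  obtain ⟨x, hxb, hx⟩ := hdense.exists_mem_open isOpen_ball ⟨a0, mem_ball_self hδ⟩
  have hxV := hδb x (by assumption)
  have hxA : ∀ j : ℕ, ∃ k, 1 ≤ k ∧ (4:ℝ) ^ j ≤ M k ∧ Real.exp (M k - √(M k)) ^ k < ‖p k x‖ := by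
    intro j
    have := mem_iInter.1 (by assumption : x ∈ ⋂ n, (A n)ᶜ) (4 ^ j)
    simp only [A, mem_compl_iff, mem_ofPred_eq, not_forall, not_le] at this
    obtain ⟨k, hk, h1, h2⟩ := this
    refine ⟨k, hk, ?_, h2⟩
    push_cast at h1
    linarith
  choose κ hκ1 hκM hκx using hxA
  have h4pos : ∀ j : ℕ, (1:ℝ) ≤ 4 ^ j := fun j => one_le_pow₀ (by norm_num)
  have hM1 : ∀ j, 1 ≤ M (κ j) := fun j => (h4pos j).trans (hκM j)
  have hκ0 : ∀ j, κ j ≠ 0 := fun j => by have := hκ1 j; omega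
  let a : ℕ → EuclideanSpace ℂ (Fin m) → ℝ := fun j z =>
    ‖p (κ j) z‖ ^ (((κ j : ℕ) : ℝ)⁻¹) / Real.exp (M (κ j))
  let w : ℕ → ℝ := fun j => (2 * M (κ j))⁻¹
  have hw0 : ∀ j, 0 ≤ w j := fun j => by
    have := hM1 j
    simp only [w]; positivity
  have hg : HasSum (fun j : ℕ => (1/2:ℝ) * (1/4:ℝ) ^ j) (1/2 * (1 - 1/4)⁻¹) :=
    (hasSum_geometric_of_lt_one (by norm_num) (by norm_num)).mul_left _
  have hwle : ∀ j, w j ≤ (1/2:ℝ) * (1/4:ℝ) ^ j := by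
    intro j
    simp only [w]
    rw [mul_inv, one_div, one_div, inv_pow]
    have := hκM j
    have := h4pos j
    gcongr
  have hws : Summable w := Summable.of_nonneg_of_le hw0 hwle hg.summable
  have hroot : ∀ j z (B : ℝ), 0 ≤ B → ‖p (κ j) z‖ ≤ B ^ (κ j) →
      ‖p (κ j) z‖ ^ (((κ j : ℕ) : ℝ)⁻¹) ≤ B := by
    intro j z B hB h
    calc _ ≤ (B ^ (κ j)) ^ (((κ j : ℕ) : ℝ)⁻¹) := by gcongr
      _ = B := Real.pow_rpow_inv_natCast hB (hκ0 j)
  have hF : Fam m a w := by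
    refine ⟨?_, ?_, ?_, hw0, hws, ?_, ?_⟩
    · intro j
      apply Continuous.div_const
      exact (hp _).continuous.norm.rpow_const (fun _ => Or.inr (by positivity))
    · intro j z
      simp only [a]; positivity
    · intro j z
      simp only [a]
      rw [div_le_iff₀ (Real.exp_pos _)]
      apply hroot j z _ (by positivity)
      rw [mul_pow, mul_comm, ← hNM _ (hκ1 j) (hM1 j)]
      exact hN _ _
    · calc _ ≤ ∑' j : ℕ, (1/2:ℝ) * (1/4:ℝ) ^ j := hws.tsum_le_tsum hwle hg.summable
        _ = _ := hg.tsum_eq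
        _ ≤ 1 := by norm_num
    · intro j y b r s hr hs hle
      have hd : Differentiable ℂ (fun t : ℂ => p (κ j) (y + t • b)) :=
        (hp _).comp (by fun_prop)
      have := nl_submean (fun t : ℂ => p (κ j) (y + t • b)) hd hr (hκ1 j)
        (Real.exp_pos (M (κ j))) hs
        (by intro θ; have := hle θ; simpa [a, circleMap] using this)
      simpa [a, circleMap] using this
  set L := Real.log (1 + ‖x‖) with hL
  have hL0 : 0 ≤ L := Real.log_nonneg (by linarith [norm_nonneg x])
  have hTx : TT a w (1 + ‖x‖) x ≠ ⊤ := by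
    have hsum : Summable (fun j : ℕ => (1 + L) * (1/2:ℝ) ^ j) :=
      (summable_geometric_of_lt_one (by norm_num) (by norm_num)).mul_left _
    have hfin : ∑' j : ℕ, ENNReal.ofReal ((1 + L) * (1/2:ℝ) ^ j) ≠ ⊤ := by
      rw [← ENNReal.ofReal_tsum_of_nonneg (fun j => by positivity) hsum]
      exact ENNReal.ofReal_ne_top
    refine ne_top_of_le_ne_top hfin ?_
    unfold TT
    apply ENNReal.tsum_le_tsum
    intro j
    have hage : Real.exp (-√(M (κ j))) / (1 + ‖x‖) ≤ a j x / (1 + ‖x‖) := by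
      gcongr
      simp only [a]
      rw [le_div_iff₀ (Real.exp_pos _), ← Real.exp_add]
      calc _ = (Real.exp (M (κ j) - √(M (κ j))) ^ (κ j)) ^ (((κ j : ℕ) : ℝ)⁻¹) := by
            rw [Real.pow_rpow_inv_natCast (Real.exp_pos _).le (hκ0 j)]; congr 1; ring
        _ ≤ _ := by
            have := (hκx j).le
            gcongr
    calc _ ≤ ENNReal.ofReal (w j) * nl (Real.exp (-√(M (κ j))) / (1 + ‖x‖)) := by
          gcongr
          exact nl_anti hage
      _ = ENNReal.ofReal (w j * (√(M (κ j)) + L)) := by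
          rw [nl_pos (by positivity), ← ENNReal.ofReal_mul (hw0 j),
            Real.log_div (Real.exp_pos _).ne' (by positivity), Real.log_exp]
          congr 2
          ring
      _ ≤ _ := by
          apply ENNReal.ofReal_le_ofReal
          have h2j : (2:ℝ) ^ j ≤ √(M (κ j)) := by
            apply Real.le_sqrt_of_sq_le
            rw [← pow_mul, mul_comm, pow_mul]
            norm_num
            exact hκM j
          have h2p : (1:ℝ) ≤ 2 ^ j := one_le_pow₀ (by norm_num)
          have hMs : M (κ j) = √(M (κ j)) * √(M (κ j)) := by
            rw [Real.mul_self_sqrt]; linarith [hM1 j]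
          set q := √(M (κ j))
          have hq : 0 < q := by linarith
          have hq1 : 1 ≤ q := by linarith
          simp only [w]
          rw [hMs, one_div, inv_pow, ← div_eq_inv_mul, ← div_eq_mul_inv,
            div_le_div_iff₀ (by positivity) (by positivity)]
          have e1 : (q + L) * 2 ^ j ≤ (q + L) * q := by gcongr
          have e2 : (q + L) * q ≤ ((1 + L) * q) * q := by
            gcongr
            nlinarith
          have e3 : 0 ≤ ((1 + L) * q) * q := by positivity
          linarith
  have hTE : ∀ z ∈ E, TT a w (1 + ‖z‖) z = ⊤ := by
    intro z hz
    obtain ⟨B, hB1, hB⟩ := hE z hz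
    by_contra hne
    have ht := ENNReal.tendsto_atTop_zero_of_tsum_ne_top hne
    have hlt : ∀ᶠ j in atTop, ENNReal.ofReal (w j) * nl (a j z / (1 + ‖z‖)) <
      ENNReal.ofReal (1/4) := by
      apply ht.eventually_lt_const
      simp
    have hbig : ∀ᶠ j : ℕ in atTop, 2 * Real.log B ≤ (4:ℝ) ^ j :=
      (tendsto_pow_atTop_atTop_of_one_lt (by norm_num)).eventually_ge_atTop _
    obtain ⟨j, h1, h2⟩ := (hlt.and hbig).exists
    apply not_le.2 h1
    have hale : a j z / (1 + ‖z‖) ≤ B / Real.exp (M (κ j)) := by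
      calc a j z / (1 + ‖z‖) ≤ a j z := div_le_self (hF.nonneg j z) (by linarith [norm_nonneg z])
        _ ≤ _ := by
          simp only [a]
          gcongr
          exact hroot j z B (by linarith) (hB _ (hκ1 j))
    have hMj := hM1 j
    have hMj2 := hκM j
    calc _ ≤ ENNReal.ofReal (w j * (M (κ j) - Real.log B)) := by
          apply ENNReal.ofReal_le_ofReal
          simp only [w]
          rw [← div_eq_inv_mul, le_div_iff₀ (by linarith)]
          linarith
      _ = ENNReal.ofReal (w j) * nl (B / Real.exp (M (κ j))) := by
          rw [nl_pos (by positivity), ← ENNReal.ofReal_mul (hw0 j),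
            Real.log_div (by positivity) (Real.exp_pos _).ne', Real.log_exp]
          congr 2
          ring
      _ ≤ _ := by
          gcongr
          exact nl_anti hale
  rw [extremal_top hF x hTx E hTE] at hxV
  exact absurd hxV (by simp)

/-- the affine chart `w ↦ (w, 1 at i)` -/
def iot {m : ℕ} (i : Fin (m + 1)) (w : EuclideanSpace ℂ (Fin m)) : EuclideanSpace ℂ (Fin (m + 1)) :=
  WithLp.toLp 2 (i.insertNth (1:ℂ) (fun j => w j) : Fin (m + 1) → ℂ)

/-- forgetting coordinate `i` -/
def prj {m : ℕ} (i : Fin (m + 1)) (z : EuclideanSpace ℂ (Fin (m + 1))) : EuclideanSpace ℂ (Fin m) :=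
  WithLp.toLp 2 (fun j => z (i.succAbove j) : Fin m → ℂ)

lemma iot_same {m : ℕ} (i : Fin (m + 1)) (w : EuclideanSpace ℂ (Fin m)) : iot i w i = 1 := by
  simp [iot]

lemma iot_succ {m : ℕ} (i : Fin (m + 1)) (w : EuclideanSpace ℂ (Fin m)) (j : Fin m) :
    iot i w (i.succAbove j) = w j := by
  simp [iot]

lemma iot_diff {m : ℕ} (i : Fin (m + 1)) : Differentiable ℂ (iot i) := by
  rw [differentiable_euclidean]
  intro l
  rcases Fin.eq_self_or_eq_succAbove i l with rfl | ⟨j, rfl⟩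
  · simp_rw [iot_same]; fun_prop
  · simp_rw [iot_succ]; fun_prop

lemma norm_split {m : ℕ} (i : Fin (m + 1)) (z : EuclideanSpace ℂ (Fin (m + 1))) :
    ‖z‖ ^ 2 = ‖z i‖ ^ 2 + ‖prj i z‖ ^ 2 := by
  rw [EuclideanSpace.norm_sq_eq, EuclideanSpace.norm_sq_eq, Fin.sum_univ_succAbove _ i]
  rfl

lemma norm_prj_le {m : ℕ} (i : Fin (m + 1)) (z : EuclideanSpace ℂ (Fin (m + 1))) :
    ‖prj i z‖ ≤ ‖z‖ := by
  have := norm_split i z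
  apply le_of_sq_le_sq _ (norm_nonneg _)
  nlinarith [sq_nonneg ‖z i‖]

lemma norm_coord_le {m : ℕ} (i : Fin (m + 1)) (z : EuclideanSpace ℂ (Fin (m + 1))) :
    ‖z i‖ ≤ ‖z‖ := by
  have := norm_split i z
  apply le_of_sq_le_sq _ (norm_nonneg _)
  nlinarith [sq_nonneg ‖prj i z‖]

lemma norm_iot_le {m : ℕ} (i : Fin (m + 1)) (w : EuclideanSpace ℂ (Fin m)) :
    ‖iot i w‖ ≤ 1 + ‖w‖ := by
  have h := norm_split i (iot i w)
  have h2 : prj i (iot i w) = w := by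
    ext j; simp [prj, iot_succ]
  rw [h2, iot_same] at h
  simp only [norm_one] at h
  apply le_of_sq_le_sq _ (by positivity)
  nlinarith [norm_nonneg w]

lemma lineCoeff_smul {n : ℕ} (S : MvPowerSeries (Fin n) ℂ) (c : ℂ) (v : EuclideanSpace ℂ (Fin n))
    (k : ℕ) : lineCoeff S (c • v) k = c ^ k * lineCoeff S v k := by
  unfold lineCoeff
  rw [Finset.mul_sum]
  apply Finset.sum_congr rfl
  intro I hI
  rw [Finset.Nat.mem_antidiagonalTuple] at hI
  simp only [PiLp.smul_apply, smul_eq_mul, mul_pow, Finset.prod_mul_distrib]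
  rw [Finset.prod_pow_eq_pow_sum, hI]
  ring

lemma lineCoeff_diff {n : ℕ} (S : MvPowerSeries (Fin n) ℂ) (k : ℕ) :
    Differentiable ℂ (fun v => lineCoeff S v k) := by
  unfold lineCoeff
  fun_prop

lemma bw {m : ℕ} (i : Fin (m + 1)) (b : EuclideanSpace ℂ (Fin m)) (ρ : ℝ) (hρ : 0 < ρ) :
    ∃ C : ℝ, 1 ≤ C ∧ ∀ (S : MvPowerSeries (Fin (m + 1)) ℂ) (k : ℕ) (A : ℝ), 0 ≤ A →
      (∀ w ∈ ball b ρ, ‖lineCoeff S (iot i w) k‖ ≤ A) →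
      ∀ z : EuclideanSpace ℂ (Fin (m + 1)), ‖z‖ ≤ 1 → ‖lineCoeff S z k‖ ≤ A * C ^ k := by
  set R : ℝ := 2 + (1 + ‖b‖) / ρ with hR
  have hR2 : 2 ≤ R := by
    have : 0 ≤ (1 + ‖b‖) / ρ := by positivity
    linarith
  refine ⟨R + 1, by linarith, ?_⟩
  intro S k A hA hw z hz
  have hd : Differentiable ℂ (fun s : ℂ => lineCoeff S (s • iot i b + z) k) :=
    (lineCoeff_diff S k).comp (by fun_prop)
  have hfr : ∀ s ∈ frontier (ball (0:ℂ) R),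
      ‖lineCoeff S (s • iot i b + z) k‖ ≤ A * (R + 1) ^ k := by
    intro s hs
    rw [frontier_ball _ (by linarith), mem_sphere_zero_iff_norm] at hs
    have hzi := (norm_coord_le i z).trans hz
    set t := s + z i with ht
    have ht1 : R - 1 ≤ ‖t‖ := by
      have := norm_sub_le t (z i)
      rw [ht, add_sub_cancel_right, hs] at this
      linarith
    have ht2 : ‖t‖ ≤ R + 1 := by
      have := norm_add_le s (z i)
      linarith
    have htpos : 0 < ‖t‖ := by linarith
    have ht0 : t ≠ 0 := norm_pos_iff.1 htpos
    set w : EuclideanSpace ℂ (Fin m) := b + t⁻¹ • (prj i z - z i • b) with hwdef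
    have heq : s • iot i b + z = t • iot i w := by
      ext l
      rcases Fin.eq_self_or_eq_succAbove i l with rfl | ⟨j, rfl⟩
      · simp [iot_same, ht]
      · simp only [PiLp.add_apply, PiLp.smul_apply, iot_succ, smul_eq_mul, hwdef, prj,
          PiLp.sub_apply]
        field_simp
        rw [ht]; ring
    have hwb : w ∈ ball b ρ := by
      rw [mem_ball_iff_norm, hwdef, add_sub_cancel_left, norm_smul, norm_inv, ← div_eq_inv_mul,
        div_lt_iff₀ htpos]
      have h1 : ‖prj i z - z i • b‖ ≤ 1 + ‖b‖ := by
        calc _ ≤ ‖prj i z‖ + ‖z i • b‖ := norm_sub_le _ _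
          _ ≤ 1 + 1 * ‖b‖ := by
            rw [norm_smul]
            gcongr
            exact (norm_prj_le i z).trans hz
          _ = _ := by ring
      have h2 : ρ * (R - 1) = ρ + (1 + ‖b‖) := by rw [hR]; field_simp; ring
      have h3 : ρ * (R - 1) ≤ ρ * ‖t‖ := by gcongr
      linarith
    rw [heq, lineCoeff_smul, norm_mul, norm_pow, mul_comm]
    have := hw w hwb
    gcongr
  have := Complex.norm_le_of_forall_mem_frontier_norm_le (U := ball (0:ℂ) R) isBounded_ball
    hd.diffContOnCl hfr (z := 0) (subset_closure (by simp; linarith))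
  simpa using this

lemma conv_of_bound {n : ℕ} (S : MvPowerSeries (Fin n) ℂ) (C : ℝ) (hC : 0 < C)
    (h : ∀ k, 1 ≤ k → ∀ z : EuclideanSpace ℂ (Fin n), ‖lineCoeff S z k‖ ≤ C ^ k * ‖z‖ ^ k) :
    ConvUnifNearZero S := by
  refine ⟨1 / (2 * C), by positivity, fun z => ∑' k, lineCoeff S z k, ?_⟩
  have hs : Summable (fun k : ℕ => (‖lineCoeff S 0 0‖ + 1) * (1/2:ℝ) ^ k) :=
    (summable_geometric_of_lt_one (by norm_num) (by norm_num)).mul_left _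
  have := tendstoUniformlyOn_tsum_nat (f := fun k z => lineCoeff S z k) hs
    (s := ball (0 : EuclideanSpace ℂ (Fin n)) (1 / (2 * C))) ?_
  · exact this
  · intro k z hz
    rw [mem_ball_zero_iff] at hz
    rcases Nat.eq_zero_or_pos k with rfl | hk
    · have h0 := lineCoeff_smul S 0 z 0
      rw [zero_smul, pow_zero, one_mul] at h0
      rw [← h0]; simp
    · calc _ ≤ C ^ k * ‖z‖ ^ k := h k hk z
        _ ≤ C ^ k * (1 / (2 * C)) ^ k := by gcongr
        _ = 1 * (1/2) ^ k := by rw [← mul_pow, one_mul]; congr 1; field_simp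
        _ ≤ _ := by
          gcongr
          linarith [norm_nonneg (lineCoeff S 0 0)]

lemma main_aux {m : ℕ} (F : Set (EuclideanSpace ℂ (Fin (m + 1))))
    (hreg : ∃ v, GeneratesRegularLeaf F v) (S : MvPowerSeries (Fin (m + 1)) ℂ)
    (hS : ∀ v ∈ F, HasPosRadius (lineCoeff S v)) : ConvUnifNearZero S := by
  obtain ⟨v, -, i, hvi, hloc⟩ := hreg
  have hmax : ∀ k, ∃ z ∈ closedBall (0 : EuclideanSpace ℂ (Fin (m + 1))) 1,
      ∀ y ∈ closedBall (0 : EuclideanSpace ℂ (Fin (m + 1))) 1,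
        ‖lineCoeff S y k‖ ≤ ‖lineCoeff S z k‖ := by
    intro k
    obtain ⟨z, hz, h⟩ := (isCompact_closedBall (0 : EuclideanSpace ℂ (Fin (m + 1))) 1).exists_isMaxOn
      ⟨0, by simp⟩ (lineCoeff_diff S k).continuous.norm.continuousOn
    exact ⟨z, hz, fun y hy => h hy⟩
  choose ζ hζ hζmax using hmax
  have hall : ∀ k z, ‖lineCoeff S z k‖ ≤ ‖lineCoeff S (ζ k) k‖ * ‖z‖ ^ k := by
    intro k z
    by_cases hz : z = 0
    · subst hz
      rcases Nat.eq_zero_or_pos k with rfl | hk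
      · simpa using hζmax 0 0 (by simp)
      · have h0 := lineCoeff_smul S 0 0 k
        rw [zero_smul, zero_pow (by omega), zero_mul] at h0
        rw [h0]; simp; positivity
    have hzn : 0 < ‖z‖ := norm_pos_iff.2 hz
    have h1 : z = (‖z‖ : ℂ) • ((‖z‖ : ℂ)⁻¹ • z) := by
      rw [smul_smul, mul_inv_cancel₀ (by exact_mod_cast hzn.ne'), one_smul]
    have h2 := hζmax k ((‖z‖ : ℂ)⁻¹ • z) (by
      rw [mem_closedBall_zero_iff, norm_smul, norm_inv, Complex.norm_real, norm_norm,
        inv_mul_cancel₀ hzn.ne'])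
    conv_lhs => rw [h1]
    rw [lineCoeff_smul, norm_mul, norm_pow, Complex.norm_real, norm_norm, mul_comm]
    gcongr
  obtain ⟨C, hC, hb⟩ := key_bound (fun k w => lineCoeff S (iot i w) k)
    (fun k => (lineCoeff_diff S k).comp (iot_diff i)) (fun k => ‖lineCoeff S (ζ k) k‖)
    (fun k => norm_nonneg _)
    (by
      intro k w
      refine (hall k (iot i w)).trans ?_
      have := norm_iot_le i w
      gcongr)
    (by
      intro b ρ hρ
      obtain ⟨C, hC1, hC⟩ := bw i b ρ hρ
      exact ⟨C, hC1, fun k A hA h => hC S k A hA h _ (by simpa using hζ k)⟩)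
    _
    (by
      rintro z ⟨⟨y, hy, hyi, hzy⟩, -⟩
      obtain ⟨r, hr, hsum⟩ := hS y hy
      have hyeq : iot i z = (y i)⁻¹ • y := by
        ext l
        rcases Fin.eq_self_or_eq_succAbove i l with rfl | ⟨j, rfl⟩
        · simp [iot_same, hyi]
        · rw [iot_succ, hzy]; simp [div_eq_inv_mul]
      set T := ∑' k, ‖lineCoeff S y k‖ * r ^ k with hT
      have hT0 : 0 ≤ T := tsum_nonneg (fun k => by positivity)
      have hyp : 0 < ‖y i‖ := norm_pos_iff.2 hyi
      refine ⟨(T + 1) / (r * ‖y i‖) + 1, by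
        have : 0 ≤ (T + 1) / (r * ‖y i‖) := by positivity
        linarith, ?_⟩
      intro k hk
      have h1 : ‖lineCoeff S y k‖ * r ^ k ≤ T := hsum.le_tsum k (fun j _ => by positivity)
      simp only
      rw [hyeq, lineCoeff_smul, norm_mul, norm_pow, norm_inv]
      calc _ ≤ ((T + 1) / (r * ‖y i‖)) ^ k := by
            rw [div_pow, mul_pow, inv_pow, ← div_eq_inv_mul, ← div_div]
            gcongr
            rw [le_div_iff₀ (by positivity)]
            calc _ ≤ T + 1 := by linarith
              _ ≤ _ := le_self_pow₀ (by linarith) (by omega)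
        _ ≤ _ := by
          gcongr
          linarith)
    _ (hloc 1 one_pos)
  apply conv_of_bound S C hC
  intro k hk z
  refine (hall k z).trans ?_
  have := hb k hk
  gcongr

/-- If the suspension `S₀(F)` has a regular leaf, then it is normal: every formal power
series converging along each leaf converges uniformly near the origin. -/
theorem normal_of_regular_leaf {m : ℕ} (hm : 1 ≤ m)
    (F : Set (EuclideanSpace ℂ (Fin (m + 1)))) (hFne : F.Nonempty)
    (hFsub : F ⊆ Metric.sphere (0 : EuclideanSpace ℂ (Fin (m + 1))) 1)
    (hreg : ∃ v, GeneratesRegularLeaf F v) :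
    ∀ S : MvPowerSeries (Fin (m + 1)) ℂ,
      (∀ v ∈ F, HasPosRadius (lineCoeff S v)) → ConvUnifNearZero S := by
  intro S hS
  exact main_aux F hreg S hS

end
end

section
/- Let {r_k}_{k≥1} be a strictly decreasing sequence in (0, π/4] converging to 0 and {s_ℓ}_{ℓ≥1} a strictly increasing sequence in (0, π/2) converging to π/2. Let P ∈ ℝ[x₁, y₁, x₂, y₂] be a real polynomial, regarded as a function of (z₁, z₂) ∈ ℂ² via z_j = x_j + i y_j. Suppose there exists a positive integer M such that P(z cos r_k, z e^{i s_ℓ} sin r_k) = 0 for all z in the open unit disc B¹ ⊆ ℂ and all integers k, ℓ ≥ M. Then P ≡ 0 on ℂ². (Consequently, the point v = (1,0) ∈ S³ generates a nonsparse leaf of the suspension S₀(F) with F = {(cos r_k, e^{i s_ℓ} sin r_k) : k, ℓ ≥ 1}.) -/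
open scoped BigOperators

theorem nsl_key (P : MvPolynomial (Fin 4) ℝ) (a b c d : ℝ → ℝ)
    (ha : ∀ x, AnalyticAt ℝ a x) (hb : ∀ x, AnalyticAt ℝ b x)
    (hc : ∀ x, AnalyticAt ℝ c x) (hd : ∀ x, AnalyticAt ℝ d x)
    (x₀ : ℝ)
    (h : ∃ᶠ x in nhdsWithin x₀ {x₀}ᶜ, MvPolynomial.eval ![a x, b x, c x, d x] P = 0) (x : ℝ) :
    MvPolynomial.eval ![a x, b x, c x, d x] P = 0 := by
  have hA : AnalyticOnNhd ℝ (fun x => MvPolynomial.eval ![a x, b x, c x, d x] P) Set.univ := by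
    intro y _
    have := AnalyticAt.aeval_mvPolynomial (𝕜 := ℝ) (f := fun x => ![a x, b x, c x, d x]) (z := y)
      (by intro i; fin_cases i
          · exact ha y
          · exact hb y
          · exact hc y
          · exact hd y) P
    simpa [MvPolynomial.aeval_eq_eval] using this
  exact hA.eqOn_zero_of_preconnected_of_frequently_eq_zero isPreconnected_univ
    (Set.mem_univ x₀) h (Set.mem_univ x)

theorem nsl_freq (p : ℝ → Prop) (u : ℕ → ℝ) (x₀ : ℝ) (M : ℕ)
    (hu : Filter.Tendsto u Filter.atTop (nhds x₀)) (hne : ∀ n, u n ≠ x₀)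
    (hp : ∀ n, M ≤ n → p (u n)) : ∃ᶠ x in nhdsWithin x₀ {x₀}ᶜ, p x := by
  have ht : Filter.Tendsto u Filter.atTop (nhdsWithin x₀ {x₀}ᶜ) :=
    tendsto_nhdsWithin_iff.2 ⟨hu, Filter.Eventually.of_forall hne⟩
  exact ht.frequently ((Filter.eventually_ge_atTop M).mono hp).frequently

/-- If a real polynomial `P ∈ ℝ[x₁,y₁,x₂,y₂]` vanishes at all points
`(z cos r_k, z e^{i s_ℓ} sin r_k)` for `z ∈ B¹` and `k, ℓ ≥ M`, where `r_k ↓ 0` in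
`(0, π/4]` and `s_ℓ ↑ π/2` in `(0, π/2)`, then `P ≡ 0` on `ℂ²`. -/
theorem nonsparse_leaf_example (r s : ℕ → ℝ)
    (hr : StrictAnti r) (hrmem : ∀ k, r k ∈ Set.Ioc 0 (Real.pi / 4))
    (hrlim : Filter.Tendsto r Filter.atTop (nhds 0))
    (hs : StrictMono s) (hsmem : ∀ l, s l ∈ Set.Ioo 0 (Real.pi / 2))
    (hslim : Filter.Tendsto s Filter.atTop (nhds (Real.pi / 2)))
    (P : MvPolynomial (Fin 4) ℝ) (M : ℕ) (hM : 0 < M)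
    (hvan : ∀ z : ℂ, ‖z‖ < 1 → ∀ k l : ℕ, M ≤ k → M ≤ l →
      MvPolynomial.eval
        ![(z * (Real.cos (r k) : ℂ)).re, (z * (Real.cos (r k) : ℂ)).im,
          (z * Complex.exp ((s l : ℂ) * Complex.I) * (Real.sin (r k) : ℂ)).re,
          (z * Complex.exp ((s l : ℂ) * Complex.I) * (Real.sin (r k) : ℂ)).im] P = 0) :
    ∀ z₁ z₂ : ℂ, MvPolynomial.eval ![z₁.re, z₁.im, z₂.re, z₂.im] P = 0 := by
  have e0 : ∀ z : ℂ, ‖z‖ < 1 → ∀ k l : ℕ, M ≤ k → M ≤ l →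
      MvPolynomial.eval ![z.re * Real.cos (r k), z.im * Real.cos (r k),
        (z.re * Real.cos (s l) - z.im * Real.sin (s l)) * Real.sin (r k),
        (z.re * Real.sin (s l) + z.im * Real.cos (s l)) * Real.sin (r k)] P = 0 := by
    intro z hz k l hk hl
    have := hvan z hz k l hk hl
    rwa [Complex.re_mul_ofReal, Complex.im_mul_ofReal, Complex.re_mul_ofReal,
      Complex.im_mul_ofReal, Complex.mul_re, Complex.mul_im, Complex.exp_ofReal_mul_I_re,
      Complex.exp_ofReal_mul_I_im] at this
  have e1 : ∀ z : ℂ, ‖z‖ < 1 → ∀ x : ℝ, ∀ l : ℕ, M ≤ l →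
      MvPolynomial.eval ![z.re * Real.cos x, z.im * Real.cos x,
        (z.re * Real.cos (s l) - z.im * Real.sin (s l)) * Real.sin x,
        (z.re * Real.sin (s l) + z.im * Real.cos (s l)) * Real.sin x] P = 0 := by
    intro z hz x l hl
    refine nsl_key P (fun x => z.re * Real.cos x) (fun x => z.im * Real.cos x)
      (fun x => (z.re * Real.cos (s l) - z.im * Real.sin (s l)) * Real.sin x)
      (fun x => (z.re * Real.sin (s l) + z.im * Real.cos (s l)) * Real.sin x)
      (fun _ => by fun_prop) (fun _ => by fun_prop) (fun _ => by fun_prop) (fun _ => by fun_prop)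
      0 ?_ x
    exact nsl_freq _ r 0 M hrlim (fun n => (hrmem n).1.ne') (fun n hn => e0 z hz n l hn hl)
  have e2 : ∀ z : ℂ, ‖z‖ < 1 → ∀ x t : ℝ,
      MvPolynomial.eval ![z.re * Real.cos x, z.im * Real.cos x,
        (z.re * Real.cos t - z.im * Real.sin t) * Real.sin x,
        (z.re * Real.sin t + z.im * Real.cos t) * Real.sin x] P = 0 := by
    intro z hz x t
    refine nsl_key P (fun _ => z.re * Real.cos x) (fun _ => z.im * Real.cos x)
      (fun t => (z.re * Real.cos t - z.im * Real.sin t) * Real.sin x)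
      (fun t => (z.re * Real.sin t + z.im * Real.cos t) * Real.sin x)
      (fun _ => by fun_prop) (fun _ => by fun_prop) (fun _ => by fun_prop) (fun _ => by fun_prop)
      (Real.pi / 2) ?_ t
    exact nsl_freq _ s _ M hslim (fun n => (hsmem n).2.ne) (fun n hn => e1 z hz x n hn)
  have e3 : ∀ z : ℂ, ∀ x t : ℝ,
      MvPolynomial.eval ![z.re * Real.cos x, z.im * Real.cos x,
        (z.re * Real.cos t - z.im * Real.sin t) * Real.sin x,
        (z.re * Real.sin t + z.im * Real.cos t) * Real.sin x] P = 0 := by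
    intro z x t
    have := nsl_key P (fun τ => (τ * z.re) * Real.cos x) (fun τ => (τ * z.im) * Real.cos x)
      (fun τ => ((τ * z.re) * Real.cos t - (τ * z.im) * Real.sin t) * Real.sin x)
      (fun τ => ((τ * z.re) * Real.sin t + (τ * z.im) * Real.cos t) * Real.sin x)
      (fun _ => by fun_prop) (fun _ => by fun_prop) (fun _ => by fun_prop) (fun _ => by fun_prop)
      0 ?_ 1
    · simpa using this
    · apply Filter.Eventually.frequently
      apply Filter.Eventually.filter_mono nhdsWithin_le_nhds
      have hc : Continuous fun τ : ℝ => ‖(τ : ℂ) * z‖ := by fun_prop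
      filter_upwards [(hc.tendsto 0).eventually_lt_const (u := 1) (by simp)] with τ hτ
      have := e2 _ hτ x t
      rwa [Complex.re_ofReal_mul, Complex.im_ofReal_mul] at this
  have e4 : ∀ z₁ z₂ : ℂ, z₁ ≠ 0 →
      MvPolynomial.eval ![z₁.re, z₁.im, z₂.re, z₂.im] P = 0 := by
    intro z₁ z₂ h1
    have hc : Real.cos (Real.arctan ‖z₂ / z₁‖) ≠ 0 := (Real.cos_arctan_pos _).ne'
    have ht := Real.tan_arctan ‖z₂ / z₁‖
    generalize Real.arctan ‖z₂ / z₁‖ = x at hc ht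
    rw [Real.tan_eq_sin_div_cos] at ht
    have hq := Complex.norm_mul_exp_arg_mul_I (z₂ / z₁)
    rw [← ht] at hq
    generalize Complex.arg (z₂ / z₁) = t at hq
    have hz2 : z₂ = (z₁ / (Real.cos x : ℂ)) * Complex.exp (t * Complex.I) * (Real.sin x : ℂ) := by
      have hc' : (Real.cos x : ℂ) ≠ 0 := by exact_mod_cast hc
      rw [eq_div_iff h1] at hq
      rw [← hq]
      push_cast
      ring
    have h := e3 (z₁ / (Real.cos x : ℂ)) x t
    have a1 : (z₁ / (Real.cos x : ℂ)).re * Real.cos x = z₁.re := by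
      rw [Complex.div_ofReal_re, div_mul_cancel₀ _ hc]
    have a2 : (z₁ / (Real.cos x : ℂ)).im * Real.cos x = z₁.im := by
      rw [Complex.div_ofReal_im, div_mul_cancel₀ _ hc]
    rw [a1, a2] at h
    rwa [hz2, Complex.re_mul_ofReal, Complex.im_mul_ofReal, Complex.mul_re, Complex.mul_im,
      Complex.exp_ofReal_mul_I_re, Complex.exp_ofReal_mul_I_im]
  intro z₁ z₂
  by_cases h1 : z₁ = 0
  · subst h1
    refine nsl_key P (fun τ => τ) (fun _ => 0) (fun _ => z₂.re) (fun _ => z₂.im)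
      (fun _ => by fun_prop) (fun _ => by fun_prop) (fun _ => by fun_prop) (fun _ => by fun_prop)
      0 ?_ 0
    apply Filter.Eventually.frequently
    filter_upwards [self_mem_nhdsWithin] with τ hτ
    have := e4 (τ : ℂ) z₂ (by exact_mod_cast hτ)
    simpa using this
  · exact e4 z₁ z₂ h1
end

section
/- Let u : ℂ → [−∞, ∞) be a subharmonic function such that u(z) ≤ C + log(1 + |z|) for some constant C and all z ∈ ℂ, and u(x) ≤ 0 for all x ∈ ℝ (the real axis {z : Im z = 0}). Then u(z) ≤ 0 for all z ∈ ℂ. Consequently, the extremal function V_ℝ is identically 0 on ℂ, i.e., the real line ℝ ⊆ ℂ is L-regular at every point; in fact V*_ℝ(z) = 0 for all z ∈ ℂ. -/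
open MeasureTheory Filter Metric Set
open scoped ENNReal

noncomputable section

/-- `u : ℂ → [-∞,∞)` is subharmonic: upper semicontinuous, not identically `-∞`,
never `+∞`, and satisfying the sub-mean value inequality over circles. -/
def IsSubharmonic (u : ℂ → EReal) : Prop :=
  UpperSemicontinuous u ∧ (∃ z, u z ≠ ⊥) ∧ (∀ z, u z ≠ ⊤) ∧
    ∀ (a : ℂ) (r : ℝ), 0 < r →
      u a ≤ (((2 * Real.pi)⁻¹ : ℝ) : EReal) *
        erealIntegral (volume.restrict (Set.Ioc (0 : ℝ) (2 * Real.pi)))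
          (fun θ : ℝ => u (a + r * Complex.exp (θ * Complex.I)))

/-- The class `L₁` of subharmonic functions on `ℂ` of logarithmic growth. -/
def LelongClassOne : Set (ℂ → EReal) :=
  {u | IsSubharmonic u ∧ ∃ C : ℝ, ∀ z : ℂ, u z ≤ ((C + Real.log (1 + ‖z‖) : ℝ) : EReal)}

/-- The Siciak extremal function `V_E` for `E ⊆ ℂ`. -/
def extremalFnOne (E : Set ℂ) (z : ℂ) : EReal :=
  sSup {x : EReal | ∃ u ∈ LelongClassOne, (∀ w ∈ E, u w ≤ 0) ∧ x = u z}

theorem aux_integral {α : Type*} [MeasurableSpace α] (μ : Measure α) [IsFiniteMeasure μ]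
    (g : α → EReal) (hg : Measurable g) (B : ℝ) (hB : ∀ x, g x ≤ (B : EReal))
    (hne : erealIntegral μ g ≠ ⊥) :
    Integrable (fun x => (g x).toReal) μ ∧ (∀ᵐ x ∂μ, g x ≠ ⊥) ∧
      erealIntegral μ g = ((∫ x, (g x).toReal ∂μ : ℝ) : EReal) := by
  have htop : ∀ x, g x ≠ ⊤ := fun x h => by
    have := hB x
    rw [h] at this
    simp at this
  have hm : Measurable erealToENNReal := measurable_ereal_toENNReal
  have hpos : ∀ x, erealToENNReal (g x) = ENNReal.ofReal (g x).toReal := fun x => by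
    simp [erealToENNReal, htop x]
  have hfin : (∫⁻ x, erealToENNReal (g x) ∂μ) ≠ ⊤ := by
    refine ne_of_lt (lt_of_le_of_lt (b := ∫⁻ x, ENNReal.ofReal |B| ∂μ) ?_ ?_)
    · refine lintegral_mono fun x => ?_
      simp only [hpos]
      by_cases hb : g x = ⊥
      · simp [hb]
      · refine ENNReal.ofReal_le_ofReal (le_trans ?_ (le_abs_self B))
        have := EReal.toReal_le_toReal (hB x) hb (EReal.coe_ne_top B)
        simpa using this
    · rw [lintegral_const]
      exact ENNReal.mul_lt_top ENNReal.ofReal_lt_top (measure_lt_top μ _)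
  have hfin2 : (∫⁻ x, erealToENNReal (-(g x)) ∂μ) ≠ ⊤ := by
    intro h
    apply hne
    unfold erealIntegral
    rw [h]
    simp [sub_eq_add_neg]
  have hmn : Measurable (fun x => erealToENNReal (-(g x))) := hm.comp hg.neg
  have hae : ∀ᵐ x ∂μ, g x ≠ ⊥ := by
    filter_upwards [ae_lt_top hmn hfin2] with x hx hb
    simp [hb, erealToENNReal] at hx
  have hneg : (∫⁻ x, erealToENNReal (-(g x)) ∂μ) = ∫⁻ x, ENNReal.ofReal (-(g x).toReal) ∂μ := by
    refine lintegral_congr_ae ?_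
    filter_upwards [hae] with x hx
    simp [erealToENNReal, EReal.neg_eq_top_iff, hx, EReal.toReal_neg_eq]
  simp only [erealIntegral, hneg] at *
  simp only [hpos] at *
  have hfm : Measurable (fun x => (g x).toReal) := measurable_ereal_toReal.comp hg
  have hint : Integrable (fun x => (g x).toReal) μ := by
    have h1 := integrable_toReal_of_lintegral_ne_top (hfm.ennreal_ofReal.aemeasurable (μ := μ)) hfin
    have h2 := integrable_toReal_of_lintegral_ne_top
      (hfm.neg.ennreal_ofReal.aemeasurable (μ := μ)) hfin2
    refine (h1.sub h2).congr (Eventually.of_forall fun x => ?_)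
    simp only [Pi.sub_apply, Pi.neg_apply, ENNReal.toReal_ofReal']
    rcases le_total 0 (g x).toReal with h | h <;> simp [h]
  refine ⟨hint, hae, ?_⟩
  rw [integral_eq_lintegral_pos_part_sub_lintegral_neg_part hint, EReal.coe_sub,
    EReal.coe_ennreal_toReal hfin, EReal.coe_ennreal_toReal hfin2]

theorem aux_strict (u : ℂ → EReal) (hsub : IsSubharmonic u) (C : ℝ)
    (hgrow : ∀ z : ℂ, u z ≤ ((C + Real.log (1 + ‖z‖) : ℝ) : EReal))
    (a : ℂ) (r : ℝ) (hr : 0 < r) (ha : u a ≠ ⊥) (G : ℂ → ℝ) (hG : Continuous G)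
    (hmean : Real.circleAverage G a r = G a) (haG : u a = (G a : EReal))
    (hle : ∀ θ : ℝ, u (circleMap a r θ) ≤ (G (circleMap a r θ) : EReal))
    (S : Set ℝ) (hS : IsOpen S) (hSne : S.Nonempty) (hSsub : S ⊆ Ioc 0 (2 * Real.pi))
    (hlt : ∀ θ ∈ S, u (circleMap a r θ) < (G (circleMap a r θ) : EReal)) : False := by
  obtain ⟨husc, -, htop, hmv⟩ := hsub
  have hmv := hmv a r hr
  change u a ≤ _ * erealIntegral _ (fun θ => u (circleMap a r θ)) at hmv
  set μ := volume.restrict (Set.Ioc (0 : ℝ) (2 * Real.pi))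
  have hpi := Real.pi_pos
  have hc : (0:ℝ) < (2 * Real.pi)⁻¹ := by positivity
  have hne : erealIntegral μ (fun θ => u (circleMap a r θ)) ≠ ⊥ := by
    intro h
    rw [h, EReal.coe_mul_bot_of_pos hc] at hmv
    exact ha (le_bot_iff.1 hmv)
  have hB : ∀ θ, u (circleMap a r θ) ≤ ((C + Real.log (1 + (‖a‖ + r)) : ℝ) : EReal) := by
    intro θ
    refine (hgrow _).trans (EReal.coe_le_coe_iff.2 ?_)
    have : ‖circleMap a r θ‖ ≤ ‖a‖ + r := by
      refine (norm_add_le _ _).trans ?_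
      simp [abs_of_pos hr]
    gcongr
  obtain ⟨hint, hae, heq⟩ := aux_integral μ (fun θ => u (circleMap a r θ))
    (husc.measurable.comp (continuous_circleMap a r).measurable) _ hB hne
  rw [heq, haG, ← EReal.coe_mul, EReal.coe_le_coe_iff, ← hmean, Real.circleAverage_def,
    intervalIntegral.integral_of_le (by positivity), smul_eq_mul] at hmv
  have hGi : Integrable (fun θ => G (circleMap a r θ)) μ :=
    (hG.comp (continuous_circleMap a r)).integrableOn_Ioc
  have hle' : (fun θ => (u (circleMap a r θ)).toReal) ≤ᵐ[μ] (fun θ => G (circleMap a r θ)) := by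
    filter_upwards [hae] with θ hθ
    simpa using EReal.toReal_le_toReal (hle θ) hθ (EReal.coe_ne_top _)
  have h1 := integral_mono_ae hint hGi hle'
  have h2 := le_antisymm h1 (le_of_mul_le_mul_left hmv hc)
  rw [integral_eq_iff_of_ae_le hint hGi hle'] at h2
  have h3 : ∀ᵐ θ ∂μ, θ ∉ S := by
    filter_upwards [h2, hae] with θ h hb hθ
    have := hlt θ hθ
    rw [← h, EReal.coe_toReal (htop _) hb] at this
    exact lt_irrefl _ this
  have h4 : μ S = 0 := by simpa [ae_iff] using h3
  rw [Measure.restrict_apply hS.measurableSet, inter_eq_left.2 hSsub] at h4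
  exact (hS.measure_pos volume hSne).ne' h4

def auxH (s : ℝ) (z : ℂ) : ℝ := Real.sqrt ((‖1 - Complex.I * s * z‖ + (1 + s * z.im)) / 2)

theorem auxH_cont (s : ℝ) : Continuous (auxH s) := by
  unfold auxH
  fun_prop

theorem auxH_eq (s : ℝ) (z : ℂ) :
    auxH s z = ((1 - Complex.I * s * z) ^ (2⁻¹ : ℂ)).re := by
  rw [Complex.cpow_inv_two_re]
  simp [auxH]

theorem auxH_lower (s : ℝ) (hs : |s| = 1) (z : ℂ) (hz : 0 ≤ s * z.im) :
    Real.sqrt (‖z‖ / 2) ≤ auxH s z := by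
  unfold auxH
  apply Real.sqrt_le_sqrt
  have h : ‖Complex.I * s * z‖ = ‖z‖ := by simp [hs]
  have := norm_sub_norm_le (Complex.I * s * z) 1
  rw [norm_sub_rev, h, norm_one] at this
  linarith

theorem auxH_harm (s : ℝ) (z : ℂ) (hz : 0 ≤ s * z.im) :
    InnerProductSpace.HarmonicAt (auxH s) z := by
  have h : AnalyticAt ℂ (fun z : ℂ => (1 - Complex.I * s * z) ^ (2⁻¹ : ℂ)) z := by
    refine AnalyticAt.cpow (by fun_prop) (by fun_prop) ?_
    left
    simp
    linarith
  have : auxH s = Complex.reCLM ∘ (fun z : ℂ => (1 - Complex.I * s * z) ^ (2⁻¹ : ℂ)) := by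
    funext z
    simp [auxH_eq]
  rw [this]
  exact h.harmonicAt.comp_CLM _

theorem aux_growth (C ε : ℝ) (hε : 0 < ε) :
    ∃ R : ℝ, 0 < R ∧ ∀ x, R ≤ x → C + Real.log (1 + x) ≤ ε * Real.sqrt (x / 2) := by
  have h1 := (isLittleO_log_rpow_atTop (show (0:ℝ) < 1/2 by norm_num)).def
    (show (0:ℝ) < ε / 4 by positivity)
  have h2 : ∀ᶠ x : ℝ in atTop, C + Real.log 2 ≤ ε / 4 * Real.sqrt x :=
    (Real.tendsto_sqrt_atTop.const_mul_atTop (by positivity)).eventually_ge_atTop _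
  obtain ⟨R, hR⟩ := eventually_atTop.1 (h1.and h2)
  refine ⟨max R 1, by positivity, fun x hx => ?_⟩
  obtain ⟨h3, h4⟩ := hR x ((le_max_left _ _).trans hx)
  have hx1 : 1 ≤ x := (le_max_right _ _).trans hx
  rw [← Real.sqrt_eq_rpow, Real.norm_eq_abs, Real.norm_eq_abs, abs_of_nonneg (Real.sqrt_nonneg x)] at h3
  have h5 : Real.log (1 + x) ≤ Real.log 2 + Real.log x := by
    rw [← Real.log_mul (by norm_num) (by positivity)]
    exact Real.log_le_log (by positivity) (by linarith)
  have h6 : Real.sqrt x / 2 ≤ Real.sqrt (x / 2) := by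
    apply Real.le_sqrt_of_sq_le
    rw [div_pow, Real.sq_sqrt (by positivity)]
    linarith
  nlinarith [le_abs_self (Real.log x)]

theorem aux_half (u : ℂ → EReal) (hsub : IsSubharmonic u) (C : ℝ)
    (hgrow : ∀ z : ℂ, u z ≤ ((C + Real.log (1 + ‖z‖) : ℝ) : EReal))
    (hreal : ∀ z : ℂ, z.im = 0 → u z ≤ 0) (s : ℝ) (hs : |s| = 1) (hs2 : s * s = 1)
    (ε : ℝ) (hε : 0 < ε) (z₀ : ℂ) (hz₀ : 0 ≤ s * z₀.im) :
    u z₀ ≤ ((ε * auxH s z₀ : ℝ) : EReal) := by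
  by_contra! hcon
  obtain ⟨R, hR, hR2⟩ := aux_growth C ε hε
  have htop := hsub.2.2.1
  have hHnn : ∀ z, 0 ≤ auxH s z := fun z => Real.sqrt_nonneg _
  have hout : ∀ z : ℂ, 0 ≤ s * z.im → R ≤ ‖z‖ → u z ≤ ((ε * auxH s z : ℝ) : EReal) := by
    intro z hz hRz
    refine (hgrow z).trans (EReal.coe_le_coe_iff.2 ((hR2 _ hRz).trans ?_))
    gcongr
    exact auxH_lower s hs z hz
  set v : ℂ → EReal := fun z => u z + ((-(ε * auxH s z) : ℝ) : EReal) with hv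
  have hHc := auxH_cont s
  have hvusc : UpperSemicontinuous v := by
    refine hsub.1.add' (Continuous.upperSemicontinuous ?_) fun x => ?_
    · exact continuous_coe_real_ereal.comp (by fun_prop)
    · exact EReal.continuousAt_add (Or.inr (EReal.coe_ne_bot _)) (Or.inr (EReal.coe_ne_top _))
  have hvle : ∀ z (m : ℝ), v z ≤ (m : EReal) ↔ u z ≤ ((m + ε * auxH s z : ℝ) : EReal) := by
    intro z m
    simp only [hv]
    have ht := htop z
    induction hu : u z with
    | bot => simp
    | top => exact absurd hu ht
    | coe x => 
      norm_cast
      constructor <;> intro h <;> linarith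
  have hvlt : ∀ z (m : ℝ), v z < (m : EReal) ↔ u z < ((m + ε * auxH s z : ℝ) : EReal) := by
    intro z m
    simp only [hv]
    have ht := htop z
    induction hu : u z with
    | bot => simp [EReal.bot_lt_coe, -EReal.coe_add]
    | top => exact absurd hu ht
    | coe x => 
      norm_cast
      constructor <;> intro h <;> linarith
  set P : Set ℂ := {z | 0 ≤ s * z.im} with hP
  have hPc : IsClosed P := isClosed_le continuous_const (by fun_prop)
  set K : Set ℂ := closedBall 0 R ∩ P with hK
  have hKc : IsCompact K := (isCompact_closedBall 0 R).inter_right hPc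
  have hz₀K : z₀ ∈ K := by
    refine ⟨?_, hz₀⟩
    by_contra h
    simp at h
    exact absurd (hout z₀ hz₀ h.le) (not_le.2 hcon)
  obtain ⟨z₁, hz₁K, hz₁⟩ := hvusc.upperSemicontinuousOn K |>.exists_isMaxOn ⟨z₀, hz₀K⟩ hKc
  have hv0 : ¬ v z₀ ≤ ((0:ℝ) : EReal) := by
    rw [hvle, zero_add]
    exact not_le.2 hcon
  have hv1 : ((0:ℝ) : EReal) < v z₁ := lt_of_lt_of_le (not_le.1 hv0) (hz₁ hz₀K)
  have hvtop : ∀ z, v z ≠ ⊤ := fun z => EReal.add_ne_top (htop z) (EReal.coe_ne_top _)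
  obtain ⟨m, hm⟩ : ∃ m : ℝ, v z₁ = (m : EReal) :=
    ⟨(v z₁).toReal, (EReal.coe_toReal (hvtop _) (ne_bot_of_gt hv1)).symm⟩
  have hm0 : 0 < m := by
    rw [hm] at hv1
    exact_mod_cast hv1
  have hmax : ∀ z ∈ P, v z ≤ (m : EReal) := by
    intro z hz
    by_cases h : ‖z‖ ≤ R
    · rw [← hm]
      exact hz₁ ⟨by simpa using h, hz⟩
    · rw [hvle]
      refine (hout z hz (not_le.1 h).le).trans (EReal.coe_le_coe_iff.2 ?_)
      linarith
  have hK2c : IsCompact (K ∩ v ⁻¹' Ici (m : EReal)) :=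
    hKc.inter_right (hvusc.isClosed_preimage _)
  obtain ⟨a, ⟨haK, hav⟩, hamin⟩ := hK2c.exists_isMinOn (f := fun z : ℂ => s * z.im)
    ⟨z₁, hz₁K, by simp [hm]⟩ (by fun_prop)
  have hveq : v a = (m : EReal) := le_antisymm (hmax a haK.2) hav
  have haim : 0 < s * a.im := by
    refine lt_of_le_of_ne haK.2 fun h => ?_
    have hs0 : s ≠ 0 := by rintro rfl; simp at hs
    have h0 : a.im = 0 := by
      rcases mul_eq_zero.1 h.symm with h | h
      · exact absurd h hs0
      · exact h
    have : v a ≤ ((0:ℝ) : EReal) := by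
      rw [hvle]
      refine (hreal a h0).trans ?_
      have := hHnn a
      exact_mod_cast (by positivity : 0 ≤ 0 + ε * auxH s a)
    rw [hveq] at this
    have : m ≤ 0 := by exact_mod_cast this
    linarith
  have hstrict : ∀ z ∈ P, s * z.im < s * a.im → v z < (m : EReal) := by
    intro z hz hlt
    refine lt_of_le_of_ne (hmax z hz) fun h => ?_
    by_cases hzR : ‖z‖ ≤ R
    · have := hamin (show z ∈ K ∩ v ⁻¹' Ici (m : EReal) from
        ⟨⟨by simpa using hzR, hz⟩, by simp [h]⟩)
      simp at this
      linarith
    · have h0 : v z ≤ ((0:ℝ) : EReal) := by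
        rw [hvle, zero_add]
        exact hout z hz (not_le.1 hzR).le
      rw [h] at h0
      have : m ≤ 0 := by exact_mod_cast h0
      linarith
  set r := s * a.im / 2 with hr
  have hr0 : 0 < r := by positivity
  have hball : closedBall a |r| ⊆ P := by
    intro z hz
    rw [mem_closedBall, dist_eq_norm, abs_of_pos hr0] at hz
    have h1 := (Complex.abs_im_le_norm (z - a)).trans hz
    have h2 : |s * (z.im - a.im)| ≤ r := by
      rw [abs_mul, hs, one_mul]; simpa using h1
    have := (abs_le.1 h2).1
    simp only [hP, mem_ofPred_eq]
    nlinarith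
  have hcm : ∀ θ, circleMap a r θ ∈ P := fun θ =>
    hball (by
      rw [abs_of_pos hr0]
      exact circleMap_mem_closedBall a hr0.le θ)
  have hpi := Real.pi_pos
  refine aux_strict u hsub C hgrow a r hr0 ?_ (fun z => m + ε * auxH s z) (by fun_prop) ?_ ?_
    (fun θ => (hvle _ _).1 (hmax _ (hcm θ)))
    {θ | θ ∈ Ioo 0 (2 * Real.pi) ∧ s * Real.sin θ < 0} ?_ ?_ ?_ ?_
  · intro h
    simp [hv, h] at hveq
  · refine InnerProductSpace.HarmonicOnNhd.circleAverage_eq fun z hz => ?_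
    have h1 : InnerProductSpace.HarmonicAt (fun _ : ℂ => (m : ℝ)) z := by
      have : AnalyticAt ℂ (fun _ : ℂ => (m : ℂ)) z := analyticAt_const
      exact this.harmonicAt.comp_CLM Complex.reCLM
    exact h1.add ((auxH_harm s z (hball hz)).const_smul (c := ε))
  · refine le_antisymm ((hvle _ _).1 hveq.le) (not_lt.1 fun h => ?_)
    exact absurd ((hvlt _ _).2 h) (by simp [hveq])
  · have h : IsOpen {θ : ℝ | s * Real.sin θ < 0} := isOpen_lt (by fun_prop) continuous_const
    exact isOpen_Ioo.inter h
  · rcases (abs_eq (by norm_num : (0:ℝ) ≤ 1)).1 hs with h | h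
    · refine ⟨3 * Real.pi / 2, ⟨by positivity, by linarith⟩, ?_⟩
      rw [show 3 * Real.pi / 2 = Real.pi / 2 + Real.pi by ring, Real.sin_add_pi]
      simp [h]
    · refine ⟨Real.pi / 2, ⟨by positivity, by linarith⟩, ?_⟩
      simp [h]
  · exact fun θ hθ => Ioo_subset_Ioc_self hθ.1
  · intro θ hθ
    refine (hvlt _ _).1 (hstrict _ (hcm θ) ?_)
    have : (circleMap a r θ).im = a.im + r * Real.sin θ := by
      simp [circleMap, Complex.exp_ofReal_mul_I_im]
    rw [this]
    have := hθ.2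
    nlinarith

theorem aux_main (u : ℂ → EReal) (hsub : IsSubharmonic u) (C : ℝ)
    (hgrow : ∀ z : ℂ, u z ≤ ((C + Real.log (1 + ‖z‖) : ℝ) : EReal))
    (hreal : ∀ z : ℂ, z.im = 0 → u z ≤ 0) (z : ℂ) : u z ≤ 0 := by
  obtain ⟨s, hs, hs2, hz⟩ : ∃ s : ℝ, |s| = 1 ∧ s * s = 1 ∧ 0 ≤ s * z.im := by
    rcases le_total 0 z.im with h | h
    · exact ⟨1, by simp, by simp, by simpa⟩
    · exact ⟨-1, by simp, by simp, by simpa⟩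
  refine le_of_not_gt fun hpos => ?_
  obtain ⟨x, hx0, hx⟩ := EReal.lt_iff_exists_real_btwn.1 hpos
  have hx0 : 0 < x := by exact_mod_cast hx0
  have hH : 0 ≤ auxH s z := Real.sqrt_nonneg _
  have := aux_half u hsub C hgrow hreal s hs hs2 (x / (auxH s z + 1)) (by positivity) z hz
  have h2 := lt_of_lt_of_le hx this
  rw [EReal.coe_lt_coe_iff, div_mul_eq_mul_div, lt_div_iff₀ (by positivity)] at h2
  nlinarith

theorem aux_zero : (fun _ : ℂ => (0 : EReal)) ∈ LelongClassOne := by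
  refine ⟨⟨upperSemicontinuous_const, ⟨0, by simp⟩, by simp, ?_⟩, 0, fun z => ?_⟩
  · intro a r hr
    simp [erealIntegral, erealToENNReal]
  · have : 0 ≤ Real.log (1 + ‖z‖) := Real.log_nonneg (by simp)
    rw [zero_add]
    show (0 : EReal) ≤ _
    exact_mod_cast this

theorem aux_ext (z : ℂ) : extremalFnOne {w : ℂ | w.im = 0} z = 0 := by
  refine le_antisymm (sSup_le ?_) (le_sSup ⟨_, aux_zero, by simp, rfl⟩)
  rintro x ⟨u, ⟨hu, C, hC⟩, h0, rfl⟩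
  exact aux_main u hu C hC h0 z

/-- **Phragmén–Lindelöf.** A subharmonic function on `ℂ` of logarithmic growth that is
`≤ 0` on the real axis is `≤ 0` everywhere; consequently `V_ℝ ≡ 0` on `ℂ`, and the real
line is L-regular at every point: `V*_ℝ(z) = 0` for all `z`. -/
theorem phragmen_lindelof_real_line (u : ℂ → EReal) (hsub : IsSubharmonic u) (C : ℝ)
    (hgrow : ∀ z : ℂ, u z ≤ ((C + Real.log (1 + ‖z‖) : ℝ) : EReal))
    (hreal : ∀ z : ℂ, z.im = 0 → u z ≤ 0) :
    (∀ z : ℂ, u z ≤ 0) ∧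
      (∀ z : ℂ, extremalFnOne {w : ℂ | w.im = 0} z = 0) ∧
      (∀ z : ℂ, Filter.limsup (extremalFnOne {w : ℂ | w.im = 0}) (nhds z) = 0) := by
  refine ⟨aux_main u hsub C hgrow hreal, aux_ext, fun z => ?_⟩
  have : extremalFnOne {w : ℂ | w.im = 0} = fun _ => 0 := funext aux_ext
  rw [this, limsup_const]

end
end
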